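/- For every dimension d ∈ ℕ and every ε > 0 there exists a constant N depending only on p, d and ε such that for every integer n ≥ 1, every r ∈ ℝ and every z ∈ ℝ^d: (∑_{i=1}^d z_i)·φ_n'(r) ≤ ε·φ_n''(r)·|z|² + N·φ_n(r), where |z| denotes the Euclidean norm of z. -/

import Mathlib

noncomputable def phi (p : ℝ) (n : ℕ) (r : ℝ) : ℝ :=
  if |r| < n then |r| ^ p
  else (n : ℝ) ^ (p - 2) * (p * (p - 1) / 2) * (|r| - n) ^ 2
        + p * (n : ℝ) ^ (p - 1) * (|r| - n) + (n : ℝ) ^ p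

theorem hasDerivAt_ite_lt {f g : ℝ → ℝ} {a x c : ℝ} (hf : x ≤ a → HasDerivAt f c x)
    (hg : a ≤ x → HasDerivAt g c x) (hfg : f a = g a) :
    HasDerivAt (fun y => if y < a then f y else g y) c x := by
  rcases lt_trichotomy x a with h | rfl | h
  · refine (hf h.le).congr_of_eventuallyEq ?_
    filter_upwards [Iio_mem_nhds h] with y hy
    exact if_pos hy
  · rw [← hasDerivWithinAt_univ, ← Set.Iic_union_Ici (a := x)]
    refine HasDerivWithinAt.union ?_ ?_
    · refine (hf le_rfl).hasDerivWithinAt.congr (fun y hy => ?_) ?_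
      · rcases (Set.mem_Iic.1 hy).lt_or_eq with h | rfl
        · exact if_pos h
        · simp [hfg]
      · simp [hfg]
    · exact (hg le_rfl).hasDerivWithinAt.congr (fun y hy => if_neg (not_lt.2 hy)) (by simp)
  · refine (hg h.le).congr_of_eventuallyEq ?_
    filter_upwards [Ioi_mem_nhds h] with y hy
    exact if_neg (not_lt.2 (le_of_lt hy))

theorem hasDerivAt_abs_rpow_mul_self {p : ℝ} (hp : 2 ≤ p) (x : ℝ) :
    HasDerivAt (fun y : ℝ => |y| ^ (p - 2) * y) ((p - 1) * |x| ^ (p - 2)) x := by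
  rcases hp.eq_or_lt with rfl | hp'
  · norm_num
    exact hasDerivAt_id x
  rcases eq_or_ne x 0 with rfl | hx
  · rw [hasDerivAt_iff_tendsto_slope]
    have hc : ContinuousAt (fun y : ℝ => |y| ^ (p - 2)) 0 :=
      continuous_abs.continuousAt.rpow_const (Or.inr (by linarith))
    have h0 : (p - 1) * |(0 : ℝ)| ^ (p - 2) = |(0 : ℝ)| ^ (p - 2) := by
      rw [abs_zero, Real.zero_rpow (by linarith), mul_zero]
    rw [h0]
    refine (hc.tendsto.mono_left nhdsWithin_le_nhds).congr' ?_
    filter_upwards [self_mem_nhdsWithin] with y hy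
    have hy' : y ≠ 0 := hy
    simp [slope_def_field, hy']
  · have h := ((hasDerivAt_abs hx).rpow_const (p := p - 2)
      (Or.inl (abs_ne_zero.2 hx))).mul (hasDerivAt_id x)
    refine h.congr_deriv ?_
    have h1 : |x| ^ (p - 2) = |x| ^ (p - 2 - 1) * |x| := by
      rw [Real.rpow_sub_one (abs_ne_zero.2 hx), div_mul_cancel₀ _ (abs_ne_zero.2 hx)]
    have h2 : (SignType.sign x : ℝ) * x = |x| := sign_mul_self x
    simp only [id]
    rw [h1]
    linear_combination (p - 2) * |x| ^ (p - 2 - 1) * h2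

theorem phi_neg (p : ℝ) (n : ℕ) (r : ℝ) : phi p n (-r) = phi p n r := by
  simp [phi]

theorem deriv_phi_neg (p : ℝ) (n : ℕ) (r : ℝ) :
    deriv (phi p n) (-r) = -deriv (phi p n) r := by
  have h := deriv_comp_neg (phi p n) r
  simp only [phi_neg] at h
  linarith

theorem deriv_deriv_phi_neg (p : ℝ) (n : ℕ) (r : ℝ) :
    deriv (deriv (phi p n)) (-r) = deriv (deriv (phi p n)) r := by
  have h := deriv_comp_neg (deriv (phi p n)) r
  simp only [deriv_phi_neg, deriv.fun_neg] at h
  linarith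

theorem rpow_sub_two_mul_self {p a : ℝ} (ha : 0 < a) : a ^ (p - 2) * a = a ^ (p - 1) := by
  rw [← Real.rpow_add_one ha.ne']
  ring_nf

theorem rpow_sub_two_mul_sq {p a : ℝ} (ha : 0 < a) : a ^ (p - 2) * a ^ 2 = a ^ p := by
  rw [← Real.rpow_natCast, ← Real.rpow_add ha]
  norm_num

theorem phi_eq_ite {p : ℝ} {n : ℕ} (hn : 0 < (n : ℝ)) {r : ℝ} (hr : -(n : ℝ) < r) :
    phi p n r = if r < n then |r| ^ p
      else (n : ℝ) ^ (p - 2) * (p * (p - 1) / 2 * (r - n) ^ 2 + p * n * (r - n) + n ^ 2) := by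
  unfold phi
  by_cases h : r < n
  · rw [if_pos h, if_pos (abs_lt.2 ⟨hr, h⟩)]
  · have hr0 : |r| = r := abs_of_pos (by linarith)
    rw [if_neg h, hr0, if_neg h, ← rpow_sub_two_mul_self hn, ← rpow_sub_two_mul_sq (p := p) hn]
    ring

theorem hasDerivAt_phi {p : ℝ} (hp : 2 ≤ p) {n : ℕ} (hn : 0 < (n : ℝ)) {r : ℝ}
    (hr : -(n : ℝ) < r) :
    HasDerivAt (phi p n) (if r < n then p * (|r| ^ (p - 2) * r)
      else (n : ℝ) ^ (p - 2) * (p * ((p - 1) * (r - n) + n))) r := by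
  have key := hasDerivAt_ite_lt (f := fun y => |y| ^ p) (a := n) (x := r)
    (g := fun y => (n : ℝ) ^ (p - 2) * (p * (p - 1) / 2 * (y - n) ^ 2 + p * n * (y - n) + n ^ 2))
    (c := if r < n then p * (|r| ^ (p - 2) * r)
      else (n : ℝ) ^ (p - 2) * (p * ((p - 1) * (r - n) + n))) ?_ ?_ ?_
  · refine key.congr_of_eventuallyEq ?_
    filter_upwards [Ioi_mem_nhds hr] with y hy
    exact phi_eq_ite hn hy
  · intro h
    refine (hasDerivAt_abs_rpow r (by linarith)).congr_deriv ?_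
    rcases h.lt_or_eq with h | rfl
    · rw [if_pos h]
      ring
    · rw [if_neg (lt_irrefl _), abs_of_pos hn]
      ring
  · intro h
    rw [if_neg (not_lt.2 h)]
    have h1 := (hasDerivAt_id r).sub_const (n : ℝ)
    refine (((((h1.pow 2).const_mul (p * (p - 1) / 2)).add
      (h1.const_mul (p * n))).add_const ((n : ℝ) ^ 2)).const_mul ((n : ℝ) ^ (p - 2))).congr_deriv ?_
    simp only [id, Nat.cast_ofNat]
    ring
  · simp [abs_of_pos hn, rpow_sub_two_mul_sq hn]

theorem hasDerivAt_deriv_phi {p : ℝ} (hp : 2 ≤ p) {n : ℕ} (hn : 0 < (n : ℝ)) {r : ℝ}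
    (hr : -(n : ℝ) < r) :
    HasDerivAt (deriv (phi p n)) (if r < n then p * ((p - 1) * |r| ^ (p - 2))
      else (n : ℝ) ^ (p - 2) * (p * (p - 1))) r := by
  have key := hasDerivAt_ite_lt (f := fun y => p * (|y| ^ (p - 2) * y)) (a := n) (x := r)
    (g := fun y => (n : ℝ) ^ (p - 2) * (p * ((p - 1) * (y - n) + n)))
    (c := if r < n then p * ((p - 1) * |r| ^ (p - 2))
      else (n : ℝ) ^ (p - 2) * (p * (p - 1))) ?_ ?_ ?_
  · refine key.congr_of_eventuallyEq ?_
    filter_upwards [Ioi_mem_nhds hr] with y hy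
    exact (hasDerivAt_phi hp hn hy).deriv
  · intro h
    refine ((hasDerivAt_abs_rpow_mul_self hp r).const_mul p).congr_deriv ?_
    rcases h.lt_or_eq with h | rfl
    · rw [if_pos h]
    · rw [if_neg (lt_irrefl _), abs_of_pos hn]
      ring
  · intro h
    rw [if_neg (not_lt.2 h)]
    refine ((((((hasDerivAt_id r).sub_const (n : ℝ)).const_mul (p - 1)).add_const
      (n : ℝ)).const_mul p).const_mul ((n : ℝ) ^ (p - 2))).congr_deriv ?_
    simp
  · simp [abs_of_pos hn]
    ring

theorem phi_deriv_bounds_of_nonneg {p : ℝ} (hp : 2 ≤ p) {n : ℕ} (hn : 0 < (n : ℝ)) {r : ℝ}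
    (hr : 0 ≤ r) :
    0 ≤ phi p n r ∧ 0 ≤ deriv (deriv (phi p n)) r ∧
      deriv (phi p n) r ^ 2 ≤ 2 * p * (phi p n r * deriv (deriv (phi p n)) r) := by
  have hr' : -(n : ℝ) < r := by linarith
  have hp1 : 0 ≤ p - 1 := by linarith
  rw [(hasDerivAt_phi hp hn hr').deriv, (hasDerivAt_deriv_phi hp hn hr').deriv,
    phi_eq_ite hn hr']
  split_ifs with h
  · refine ⟨by positivity, by positivity, ?_⟩
    rw [abs_of_nonneg hr]
    rcases hr.eq_or_lt with rfl | hr0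
    · rw [Real.zero_rpow (by linarith : p ≠ 0)]
      simp
    · rw [← rpow_sub_two_mul_sq (p := p) hr0]
      have h0 : 0 ≤ (r ^ (p - 2) * r) ^ 2 * p ^ 2 * (2 * (p - 1) - 1) :=
        mul_nonneg (by positivity) (by linarith)
      linarith
  · have hs : 0 ≤ r - n := by linarith
    set s := r - (n : ℝ)
    refine ⟨by positivity, by positivity, ?_⟩
    have h1 : ((p - 1) * s + n) ^ 2 ≤
        2 * (p - 1) * (p * (p - 1) / 2 * s ^ 2 + p * n * s + n ^ 2) := by
      have e1 : 0 ≤ (p - 1) ^ 3 * s ^ 2 := by positivity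
      have e2 : 0 ≤ (p - 1) ^ 2 * (n * s) := by positivity
      have e3 : 0 ≤ (2 * p - 3) * (n : ℝ) ^ 2 := mul_nonneg (by linarith) (by positivity)
      linarith
    have h2 := mul_le_mul_of_nonneg_left h1 (by positivity : 0 ≤ ((n : ℝ) ^ (p - 2) * p) ^ 2)
    linarith

theorem phi_deriv_bounds {p : ℝ} (hp : 2 ≤ p) {n : ℕ} (hn : 0 < (n : ℝ)) (r : ℝ) :
    0 ≤ phi p n r ∧ 0 ≤ deriv (deriv (phi p n)) r ∧
      deriv (phi p n) r ^ 2 ≤ 2 * p * (phi p n r * deriv (deriv (phi p n)) r) := by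
  rcases le_total 0 r with hr | hr
  · exact phi_deriv_bounds_of_nonneg hp hn hr
  · have h := phi_deriv_bounds_of_nonneg hp hn (neg_nonneg.2 hr)
    rwa [phi_neg, deriv_phi_neg, deriv_deriv_phi_neg, neg_sq] at h

theorem le_add_of_sq_le_four_mul {w x y : ℝ} (hx : 0 ≤ x) (hy : 0 ≤ y)
    (h : w ^ 2 ≤ 4 * (x * y)) : w ≤ x + y :=
  le_of_sq_le_sq (by nlinarith [sq_nonneg (x - y)]) (add_nonneg hx hy)

theorem EuclideanSpace.sq_sum_le {d : ℕ} (z : EuclideanSpace ℝ (Fin d)) :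
    (∑ i, z i) ^ 2 ≤ d * ‖z‖ ^ 2 := by
  have h := sq_sum_le_card_mul_sum_sq (s := Finset.univ) (f := fun i => z i)
  rw [EuclideanSpace.real_norm_sq_eq]
  simpa using h

theorem phi_gradient_young_bound (p : ℝ) (hp : 2 ≤ p) :
    ∀ (d : ℕ) (ε : ℝ), 0 < ε → ∃ N : ℝ,
      ∀ n : ℕ, 1 ≤ n → ∀ (r : ℝ) (z : EuclideanSpace ℝ (Fin d)),
        (∑ i, z i) * deriv (phi p n) r ≤
          ε * deriv (deriv (phi p n)) r * ‖z‖ ^ 2 + N * phi p n r := by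
  intro d ε hε
  refine ⟨p * d / (2 * ε), fun n hn r z => ?_⟩
  obtain ⟨h0, h2, h⟩ := phi_deriv_bounds hp (n := n) (by exact_mod_cast hn) r
  refine le_add_of_sq_le_four_mul (by positivity) (by positivity) ?_
  calc ((∑ i, z i) * deriv (phi p n) r) ^ 2
      = (∑ i, z i) ^ 2 * deriv (phi p n) r ^ 2 := mul_pow _ _ _
    _ ≤ (d * ‖z‖ ^ 2) * (2 * p * (phi p n r * deriv (deriv (phi p n)) r)) :=
        mul_le_mul (EuclideanSpace.sq_sum_le z) h (sq_nonneg _) (by positivity)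
    _ = 4 * (ε * deriv (deriv (phi p n)) r * ‖z‖ ^ 2 * (p * d / (2 * ε) * phi p n r)) := by
        field_simp
        ring
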